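/- For every integer n and every polynomial v in the bosonic Fock space F = ℝ[x₁, x₂, …], the set of integers m for which :a_{n−m} aₘ: v ≠ 0 is finite; consequently Lₙ v := (1/2) Σ_{m∈ℤ} :a_{n−m} aₘ: v is a well-defined element of F and Lₙ defines a linear endomorphism of F. -/

import Mathlib

/- Bosonic Fock space `F = ℝ[x₁, x₂, …]`, realized as `MvPolynomial ℕ ℝ`
(the variable `x₀` is never used: only indices `≥ 1` occur).
Heisenberg modes: `a₀ = λ·id`, `aₙ = n·∂/∂xₙ` and `a₋ₙ = (mult by xₙ)` for `n ≥ 1`. -/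
noncomputable def heis (lam : ℝ) (n : ℤ) : Module.End ℝ (MvPolynomial ℕ ℝ) :=
  if n = 0 then lam • (LinearMap.id : MvPolynomial ℕ ℝ →ₗ[ℝ] MvPolynomial ℕ ℝ)
  else if 0 < n then (n : ℝ) • (MvPolynomial.pderiv (R := ℝ) (n.toNat)).toLinearMap
  else LinearMap.mulLeft ℝ (MvPolynomial.X ((-n).toNat))

/- Normal ordering `:a_j a_k:` : the operator with positive index is placed to the
right (i.e. acts first) of the one with nonpositive index. -/
noncomputable def nord (lam : ℝ) (j k : ℤ) : Module.End ℝ (MvPolynomial ℕ ℝ) :=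
  if j ≤ k then heis lam j ∘ₗ heis lam k else heis lam k ∘ₗ heis lam j

/-- Annihilation modes of large index kill a given polynomial. -/
theorem exists_heis_apply_eq_zero (lam : ℝ) (v : MvPolynomial ℕ ℝ) :
    ∃ B : ℤ, ∀ k : ℤ, B < k → heis lam k v = 0 := by
  refine ⟨(v.vars.sup id : ℕ), fun k hk => ?_⟩
  have hpos : 0 < k := by omega
  have hnot : k.toNat ∉ v.vars := fun hmem => by
    have hle : k.toNat ≤ v.vars.sup id := Finset.le_sup (f := id) hmem
    omega
  simp [heis, hpos.ne', hpos, MvPolynomial.pderiv_eq_zero_of_notMem_vars hnot]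

theorem finite_setOf_nord_apply_ne_zero (lam : ℝ) (n : ℤ) (v : MvPolynomial ℕ ℝ) :
    {m : ℤ | nord lam (n - m) m v ≠ 0}.Finite := by
  obtain ⟨B, hB⟩ := exists_heis_apply_eq_zero lam v
  refine (Set.finite_Icc (n - B) B).subset fun m hm => ?_
  by_contra hmem
  refine hm ?_
  rw [Set.mem_Icc] at hmem
  unfold nord
  split_ifs with h
  · rw [LinearMap.comp_apply, hB m (by omega), map_zero]
  · rw [LinearMap.comp_apply, hB (n - m) (by omega), map_zero]

/-- For every integer `n` and every polynomial `v` in the bosonic Fock space, the set of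
integers `m` with `:a_{n−m} aₘ: v ≠ 0` is finite; consequently
`Lₙ v := (1/2) Σ_{m∈ℤ} :a_{n−m} aₘ: v` is a well-defined element of `F` and `Lₙ`
defines a linear endomorphism of `F`. -/
theorem statement0 (lam : ℝ) (n : ℤ) :
    (∀ v : MvPolynomial ℕ ℝ, {m : ℤ | nord lam (n - m) m v ≠ 0}.Finite) ∧
    ∃ L : Module.End ℝ (MvPolynomial ℕ ℝ),
      ∀ v : MvPolynomial ℕ ℝ, L v = (2⁻¹ : ℝ) • ∑ᶠ m : ℤ, nord lam (n - m) m v := by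
  have hfin := finite_setOf_nord_apply_ne_zero lam n
  refine ⟨hfin, (2⁻¹ : ℝ) •
    { toFun := fun v => ∑ᶠ m : ℤ, nord lam (n - m) m v
      map_add' := fun v w => ?_
      map_smul' := fun c v => ?_ }, fun v => rfl⟩
  · simp only [map_add]
    exact finsum_add_distrib (hfin v) (hfin w)
  · simp only [map_smul, RingHom.id_apply]
    exact (smul_finsum c _).symm
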